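/- arXiv:1609.07438 — 4 statements merged into one kernel-verified Lean document; each statement's English description precedes it below -/
import Mathlib

section
/- For every real α, the antisymmetric 3×3 matrix-valued map Π_α on ℝ³ with entries (Π_α)_{12}(x) = (α−1)x₃ − αx₂, (Π_α)_{13}(x) = (1−α)x₂ + αx₃, (Π_α)_{23}(x) = −(1+α)x₁, satisfies the coordinate Jacobi identity: for all i,j,k ∈ {1,2,3} and all x ∈ ℝ³, ∑_{l=1}^{3} ( (Π_α)_{li}(x) ∂_l (Π_α)_{jk}(x) + (Π_α)_{lj}(x) ∂_l (Π_α)_{ki}(x) + (Π_α)_{lk}(x) ∂_l (Π_α)_{ij}(x) ) = 0. In particular the so(3) linear Poisson structure (α=0, with entries Π_{12} = −x₃, Π_{13} = x₂, Π_{23} = −x₁) and the sl(2,ℝ) linear Poisson structure (α=1, with entries Π_{12} = −x₂, Π_{13} = x₃, Π_{23} = −2x₁) are compatible. -/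
/-- Partial derivative ∂_l of a real-valued function on ℝⁿ at x. -/
noncomputable def pd {n : ℕ} (f : (Fin n → ℝ) → ℝ) (l : Fin n) (x : Fin n → ℝ) : ℝ :=
  fderiv ℝ f x (Pi.single l 1)

/-- The pencil Π_α of linear Poisson structures on ℝ³:
(Π_α)₁₂ = (α−1)x₃ − αx₂, (Π_α)₁₃ = (1−α)x₂ + αx₃, (Π_α)₂₃ = −(1+α)x₁. -/
noncomputable def PiAlpha (α : ℝ) (x : Fin 3 → ℝ) : Matrix (Fin 3) (Fin 3) ℝ :=
  !![0, (α - 1) * x 2 - α * x 1, (1 - α) * x 1 + α * x 2;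
     -((α - 1) * x 2 - α * x 1), 0, -(1 + α) * x 0;
     -((1 - α) * x 1 + α * x 2), (1 + α) * x 0, 0]

/-- The partial derivative of a linear function is its value on the basis vector. -/
theorem pd_eq_of_isLinearMap {n : ℕ} {f : (Fin n → ℝ) → ℝ} (hf : IsLinearMap ℝ f)
    (l : Fin n) (x : Fin n → ℝ) : pd f l x = f (Pi.single l 1) :=
  congrArg (fun g : (Fin n → ℝ) →L[ℝ] ℝ => g (Pi.single l 1))
    (hf.mk' f).toContinuousLinearMap.fderiv

theorem isLinearMap_PiAlpha (α : ℝ) (j k : Fin 3) :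
    IsLinearMap ℝ (fun y => PiAlpha α y j k) := by
  constructor <;> intros <;> fin_cases j <;> fin_cases k <;> simp [PiAlpha] <;> ring

theorem pd_PiAlpha (α : ℝ) (j k l : Fin 3) (x : Fin 3 → ℝ) :
    pd (fun y => PiAlpha α y j k) l x = PiAlpha α (Pi.single l 1) j k :=
  pd_eq_of_isLinearMap (isLinearMap_PiAlpha α j k) l x

/-- For every α, Π_α satisfies the coordinate Jacobi identity; in particular the
so(3) (α = 0) and sl(2,ℝ) (α = 1) linear Poisson structures are compatible. -/
theorem euler_pencil_jacobi (α : ℝ) (i j k : Fin 3) (x : Fin 3 → ℝ) :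
    ∑ l : Fin 3,
      (PiAlpha α x l i * pd (fun y => PiAlpha α y j k) l x
        + PiAlpha α x l j * pd (fun y => PiAlpha α y k i) l x
        + PiAlpha α x l k * pd (fun y => PiAlpha α y i j) l x) = 0 := by
  simp only [pd_PiAlpha, Fin.sum_univ_three]
  fin_cases i <;> fin_cases j <;> fin_cases k <;> simp [PiAlpha] <;> ring
end

section
/- Let Π₀ and Π₁ be the antisymmetric 3×3 matrix-valued maps on ℝ³ with upper-triangular entries (Π₀)_{12}(x) = −x₃, (Π₀)_{13}(x) = x₂, (Π₀)_{23}(x) = −x₁ and (Π₁)_{12}(x) = −x₂, (Π₁)_{13}(x) = x₃, (Π₁)_{23}(x) = −2x₁, and let H₀(x) = x₁² + x₂x₃ and H₁(x) = −(x₁² + x₂² + x₃²)/2. Then for all x ∈ ℝ³: Π₀(x)∇H₀(x) = Π₁(x)∇H₁(x) = ( x₂² − x₃², x₁(2x₃ − x₂), x₁(x₃ − 2x₂) ). Hence the Euler top system ẋ₁ = x₂² − x₃², ẋ₂ = x₁(2x₃ − x₂), ẋ₃ = x₁(x₃ − 2x₂) is bi-Hamiltonian with respect to (Π₀, H₀)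 and (Π₁, H₁); moreover H₀ is a Casimir of Π₁ and H₁ is a Casimir of Π₀, i.e. Π₁(x)∇H₀(x) = 0 and Π₀(x)∇H₁(x) = 0 for all x. -/
/-- Gradient of a real-valued function on ℝⁿ at x. -/
noncomputable def grad {n : ℕ} (f : (Fin n → ℝ) → ℝ) (x : Fin n → ℝ) : Fin n → ℝ :=
  fun l => pd f l x

/-- The so(3) linear Poisson structure Π₀ on ℝ³:
(Π₀)₁₂ = −x₃, (Π₀)₁₃ = x₂, (Π₀)₂₃ = −x₁. -/
noncomputable def Pi0 (x : Fin 3 → ℝ) : Matrix (Fin 3) (Fin 3) ℝ :=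
  !![0, -(x 2), x 1;
     x 2, 0, -(x 0);
     -(x 1), x 0, 0]

/-- The sl(2,ℝ) linear Poisson structure Π₁ on ℝ³:
(Π₁)₁₂ = −x₂, (Π₁)₁₃ = x₃, (Π₁)₂₃ = −2x₁. -/
noncomputable def Pi1 (x : Fin 3 → ℝ) : Matrix (Fin 3) (Fin 3) ℝ :=
  !![0, -(x 1), x 2;
     x 1, 0, -(2 * x 0);
     -(x 2), 2 * x 0, 0]

/-- H₀(x) = x₁² + x₂x₃. -/
noncomputable def H0 (x : Fin 3 → ℝ) : ℝ := (x 0) ^ 2 + x 1 * x 2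

/-- H₁(x) = −(x₁² + x₂² + x₃²)/2. -/
noncomputable def H1 (x : Fin 3 → ℝ) : ℝ := -((x 0) ^ 2 + (x 1) ^ 2 + (x 2) ^ 2) / 2

theorem grad_eq_of_hasFDerivAt {n : ℕ} {f : (Fin n → ℝ) → ℝ} {x : Fin n → ℝ}
    {f' : (Fin n → ℝ) →L[ℝ] ℝ} (h : HasFDerivAt f f' x) :
    grad f x = fun l => f' (Pi.single l 1) := by
  funext l
  simp only [grad, pd, h.fderiv]

theorem grad_H0 (x : Fin 3 → ℝ) : grad H0 x = ![2 * x 0, x 2, x 1] := by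
  have hc (i : Fin 3) := hasFDerivAt_apply (𝕜 := ℝ) i x
  have h : HasFDerivAt H0 _ x := ((hc 0).pow 2).add ((hc 1).mul (hc 2))
  rw [grad_eq_of_hasFDerivAt h]
  funext l
  fin_cases l <;> simp

theorem grad_H1 (x : Fin 3 → ℝ) : grad H1 x = ![-x 0, -x 1, -x 2] := by
  have hc (i : Fin 3) := hasFDerivAt_apply (𝕜 := ℝ) i x
  have h : HasFDerivAt H1 _ x :=
    ((((hc 0).pow 2).add ((hc 1).pow 2)).add ((hc 2).pow 2)).neg.mul_const (2 : ℝ)⁻¹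
  rw [grad_eq_of_hasFDerivAt h]
  funext l
  fin_cases l <;> simp

/-- The Euler top system ẋ₁ = x₂² − x₃², ẋ₂ = x₁(2x₃ − x₂), ẋ₃ = x₁(x₃ − 2x₂) is
bi-Hamiltonian with respect to (Π₀, H₀) and (Π₁, H₁); moreover H₀ is a Casimir of
Π₁ and H₁ is a Casimir of Π₀. -/
theorem euler_top_biHamiltonian (x : Fin 3 → ℝ) :
    Matrix.mulVec (Pi0 x) (grad H0 x)
      = ![(x 1) ^ 2 - (x 2) ^ 2, x 0 * (2 * x 2 - x 1), x 0 * (x 2 - 2 * x 1)] ∧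
    Matrix.mulVec (Pi1 x) (grad H1 x)
      = ![(x 1) ^ 2 - (x 2) ^ 2, x 0 * (2 * x 2 - x 1), x 0 * (x 2 - 2 * x 1)] ∧
    Matrix.mulVec (Pi1 x) (grad H0 x) = 0 ∧
    Matrix.mulVec (Pi0 x) (grad H1 x) = 0 := by
  rw [grad_H0, grad_H1]
  refine ⟨?_, ?_, ?_, ?_⟩ <;> funext i <;> fin_cases i <;>
    simp [Pi0, Pi1, Matrix.mulVec, dotProduct, Fin.sum_univ_three] <;> ring
end

section
/- For every real α and every real η ≠ 0, the antisymmetric 3×3 matrix-valued map Π_{αη} on ℝ³ with entries (Π_{αη})_{12}(x) = (α−1)x₃ − αx₂, (Π_{αη})_{13}(x) = (1−α)x₂ + αx₃, (Π_{αη})_{23}(x) = η(α−1)(x₂²/2 + x₃²/2) − ηαx₂x₃ + (1+α)(e^{−2ηx₁} − 1)/(2η), satisfies the coordinate Jacobi identity: for all i,j,k ∈ {1,2,3} and all x ∈ ℝ³, ∑_{l=1}^{3} ( (Π_{αη})_{li}(x) ∂_l (Π_{αη})_{jk}(x) + (Π_{αη})_{lj}(x) ∂_l (Π_{αη})_{ki}(x)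 + (Π_{αη})_{lk}(x) ∂_l (Π_{αη})_{ij}(x) ) = 0. In particular the deformed structures Π_{0η} (α=0) and Π_{1η} (α=1) are compatible Poisson structures on ℝ³. -/
open Real

/-- The deformed pencil Π_{αη} on ℝ³:
(Π_{αη})₁₂ = (α−1)x₃ − αx₂, (Π_{αη})₁₃ = (1−α)x₂ + αx₃,
(Π_{αη})₂₃ = η(α−1)(x₂²/2 + x₃²/2) − ηαx₂x₃ + (1+α)(e^{−2ηx₁} − 1)/(2η). -/
noncomputable def PiAlphaEta (α η : ℝ) (x : Fin 3 → ℝ) : Matrix (Fin 3) (Fin 3) ℝ :=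
  !![0, (α - 1) * x 2 - α * x 1, (1 - α) * x 1 + α * x 2;
     -((α - 1) * x 2 - α * x 1), 0,
        η * (α - 1) * ((x 1) ^ 2 / 2 + (x 2) ^ 2 / 2) - η * α * x 1 * x 2
          + (1 + α) * (exp (-2 * η * x 0) - 1) / (2 * η);
     -((1 - α) * x 1 + α * x 2),
        -(η * (α - 1) * ((x 1) ^ 2 / 2 + (x 2) ^ 2 / 2) - η * α * x 1 * x 2
          + (1 + α) * (exp (-2 * η * x 0) - 1) / (2 * η)), 0]

theorem pd_const {n : ℕ} (c : ℝ) (l : Fin n) (x : Fin n → ℝ) : pd (fun _ => c) l x = 0 := by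
  simp [pd]

theorem pd_neg {n : ℕ} (f : (Fin n → ℝ) → ℝ) (l : Fin n) (x : Fin n → ℝ) :
    pd (fun y => -f y) l x = -pd f l x := by
  simp [pd, fderiv_fun_neg]

theorem pd_eq_of_hasFDerivAt {n : ℕ} {f : (Fin n → ℝ) → ℝ} {f' : (Fin n → ℝ) →L[ℝ] ℝ}
    {x : Fin n → ℝ} (h : HasFDerivAt f f' x) (l : Fin n) : pd f l x = f' (Pi.single l 1) := by
  rw [pd, h.fderiv]

theorem pd_linear (a b : ℝ) (l : Fin 3) (x : Fin 3 → ℝ) :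
    pd (fun y => a * y 1 + b * y 2) l x = ![0, a, b] l := by
  have h := ((hasFDerivAt_apply (𝕜 := ℝ) (1 : Fin 3) x).const_mul a).add
    ((hasFDerivAt_apply (𝕜 := ℝ) (2 : Fin 3) x).const_mul b)
  refine (pd_eq_of_hasFDerivAt h l).trans ?_
  fin_cases l <;> simp

theorem pd_PiAlphaEta_zero_one (α : ℝ) (l : Fin 3) (x : Fin 3 → ℝ) :
    pd (fun y => (α - 1) * y 2 - α * y 1) l x = ![0, -α, α - 1] l := by
  rw [← pd_linear (-α) (α - 1) l x]
  congr 1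
  funext y
  ring

theorem pd_PiAlphaEta_one_two (α η : ℝ) (hη : η ≠ 0) (l : Fin 3) (x : Fin 3 → ℝ) :
    pd (fun y => η * (α - 1) * ((y 1) ^ 2 / 2 + (y 2) ^ 2 / 2) - η * α * y 1 * y 2
          + (1 + α) * (exp (-2 * η * y 0) - 1) / (2 * η)) l x =
      ![-(1 + α) * exp (-2 * η * x 0), -η * ((1 - α) * x 1 + α * x 2),
        η * ((α - 1) * x 2 - α * x 1)] l := by
  have h0 := hasFDerivAt_apply (𝕜 := ℝ) (0 : Fin 3) x
  have h1 := hasFDerivAt_apply (𝕜 := ℝ) (1 : Fin 3) x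
  have h2 := hasFDerivAt_apply (𝕜 := ℝ) (2 : Fin 3) x
  have h := (((((h1.pow 2).mul_const (2⁻¹ : ℝ)).add ((h2.pow 2).mul_const (2⁻¹ : ℝ))).const_mul
    (η * (α - 1))).sub ((h1.const_mul (η * α)).mul h2)).add
    ((((h0.const_mul (-2 * η)).exp.sub_const 1).const_mul (1 + α)).mul_const (2 * η)⁻¹)
  refine (pd_eq_of_hasFDerivAt h l).trans ?_
  fin_cases l <;> simp <;> field_simp <;> ring

/-- For every α and η ≠ 0, Π_{αη} satisfies the coordinate Jacobi identity; in
particular Π_{0η} and Π_{1η} are compatible Poisson structures on ℝ³. -/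
theorem deformed_euler_pencil_jacobi (α η : ℝ) (hη : η ≠ 0) (i j k : Fin 3)
    (x : Fin 3 → ℝ) :
    ∑ l : Fin 3,
      (PiAlphaEta α η x l i * pd (fun y => PiAlphaEta α η y j k) l x
        + PiAlphaEta α η x l j * pd (fun y => PiAlphaEta α η y k i) l x
        + PiAlphaEta α η x l k * pd (fun y => PiAlphaEta α η y i j) l x) = 0 := by
  have h12 := fun l => pd_PiAlphaEta_zero_one α l x
  have h13 := fun l => pd_linear (1 - α) α l x
  have h23 := fun l => pd_PiAlphaEta_one_two α η hη l x
  fin_cases i <;> fin_cases j <;> fin_cases k <;>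
    simp only [PiAlphaEta, Fin.sum_univ_three, Fin.zero_eta, Fin.mk_one, Fin.reduceFinMk,
      Matrix.of_apply, Matrix.cons_val, pd_neg, pd_const, h12, h13, h23] <;>
    ring
end

section
/- Fix a real η ≠ 0. Let Π_{0η} and Π_{1η} be the antisymmetric 3×3 matrix-valued maps on ℝ³ with upper-triangular entries (Π_{0η})_{12}(x) = −x₃, (Π_{0η})_{13}(x) = x₂, (Π_{0η})_{23}(x) = −η(x₂²/2 + x₃²/2) + (e^{−2ηx₁} − 1)/(2η) and (Π_{1η})_{12}(x) = −x₂, (Π_{1η})_{13}(x) = x₃, (Π_{1η})_{23}(x) = −ηx₂x₃ + (e^{−2ηx₁} − 1)/η. Define C_{0η}(x) = −e^{ηx₁}(x₂² + x₃²)/2 − (e^{ηx₁} + e^{−ηx₁} − 2)/(2η²) and C_{1η}(x) = e^{ηx₁}x₂x₃ + (e^{ηx₁} + e^{−ηx₁} − 2)/η². Then for all x ∈ ℝ³: Π_{0η}(x)∇C_{0η}(x) = 0 and Π_{1η}(x)∇C_{1η}(x) = 0; that is, C_{0η} is a Casimir function of Π_{0η} and C_{1η} is a Casimir function of Π_{1η}.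 -/
open Real

/-- Π_{0η} on ℝ³: (Π_{0η})₁₂ = −x₃, (Π_{0η})₁₃ = x₂,
(Π_{0η})₂₃ = −η(x₂²/2 + x₃²/2) + (e^{−2ηx₁} − 1)/(2η). -/
noncomputable def Pi0Eta (η : ℝ) (x : Fin 3 → ℝ) : Matrix (Fin 3) (Fin 3) ℝ :=
  !![0, -(x 2), x 1;
     x 2, 0, -η * ((x 1) ^ 2 / 2 + (x 2) ^ 2 / 2) + (exp (-2 * η * x 0) - 1) / (2 * η);
     -(x 1), -(-η * ((x 1) ^ 2 / 2 + (x 2) ^ 2 / 2) + (exp (-2 * η * x 0) - 1) / (2 * η)), 0]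

/-- Π_{1η} on ℝ³: (Π_{1η})₁₂ = −x₂, (Π_{1η})₁₃ = x₃,
(Π_{1η})₂₃ = −ηx₂x₃ + (e^{−2ηx₁} − 1)/η. -/
noncomputable def Pi1Eta (η : ℝ) (x : Fin 3 → ℝ) : Matrix (Fin 3) (Fin 3) ℝ :=
  !![0, -(x 1), x 2;
     x 1, 0, -η * x 1 * x 2 + (exp (-2 * η * x 0) - 1) / η;
     -(x 2), -(-η * x 1 * x 2 + (exp (-2 * η * x 0) - 1) / η), 0]

/-- C_{0η}(x) = −e^{ηx₁}(x₂² + x₃²)/2 − (e^{ηx₁} + e^{−ηx₁} − 2)/(2η²). -/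
noncomputable def C0Eta (η : ℝ) (x : Fin 3 → ℝ) : ℝ :=
  -(exp (η * x 0) * ((x 1) ^ 2 + (x 2) ^ 2) / 2)
    - (exp (η * x 0) + exp (-(η * x 0)) - 2) / (2 * η ^ 2)

/-- C_{1η}(x) = e^{ηx₁}x₂x₃ + (e^{ηx₁} + e^{−ηx₁} − 2)/η². -/
noncomputable def C1Eta (η : ℝ) (x : Fin 3 → ℝ) : ℝ :=
  exp (η * x 0) * x 1 * x 2 + (exp (η * x 0) + exp (-(η * x 0)) - 2) / η ^ 2

theorem HasFDerivAt.grad_eq {n : ℕ} {f : (Fin n → ℝ) → ℝ} {f' : (Fin n → ℝ) →L[ℝ] ℝ}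
    {x : Fin n → ℝ} (h : HasFDerivAt f f' x) : grad f x = fun l => f' (Pi.single l 1) := by
  funext l
  rw [grad, pd, h.fderiv]

theorem hasFDerivAt_exp_mul_coord {n : ℕ} (c : ℝ) (i : Fin n) (x : Fin n → ℝ) :
    HasFDerivAt (fun y : Fin n → ℝ => exp (c * y i))
      (exp (c * x i) • c • ContinuousLinearMap.proj (R := ℝ) (φ := fun _ : Fin n => ℝ) i) x :=
  ((hasFDerivAt_apply i x).const_mul c).exp

theorem hasFDerivAt_exp_neg_mul_coord {n : ℕ} (c : ℝ) (i : Fin n) (x : Fin n → ℝ) :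
    HasFDerivAt (fun y : Fin n → ℝ => exp (-(c * y i)))
      (exp (-(c * x i)) • -(c • ContinuousLinearMap.proj (R := ℝ) (φ := fun _ : Fin n => ℝ) i)) x :=
  ((hasFDerivAt_apply i x).const_mul c).fun_neg.exp

theorem grad_C0Eta {η : ℝ} (hη : η ≠ 0) (x : Fin 3 → ℝ) :
    grad (C0Eta η) x =
      ![-(η * exp (η * x 0) * ((x 1) ^ 2 + (x 2) ^ 2) / 2)
          - (exp (η * x 0) - exp (-(η * x 0))) / (2 * η),
        -(exp (η * x 0) * x 1), -(exp (η * x 0) * x 2)] := by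
  have h := (((hasFDerivAt_exp_mul_coord η 0 x).mul
    (((hasFDerivAt_apply 1 x).pow 2).add ((hasFDerivAt_apply 2 x).pow 2))).mul_const
      (2 : ℝ)⁻¹).neg.sub
    ((((hasFDerivAt_exp_mul_coord η 0 x).add (hasFDerivAt_exp_neg_mul_coord η 0 x)).sub_const
      2).mul_const (2 * η ^ 2)⁻¹)
  refine (HasFDerivAt.grad_eq (f := C0Eta η) h).trans ?_
  funext l
  fin_cases l <;> simp <;> field_simp
  ring

theorem grad_C1Eta {η : ℝ} (hη : η ≠ 0) (x : Fin 3 → ℝ) :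
    grad (C1Eta η) x =
      ![η * exp (η * x 0) * x 1 * x 2 + (exp (η * x 0) - exp (-(η * x 0))) / η,
        exp (η * x 0) * x 2, exp (η * x 0) * x 1] := by
  have h := (((hasFDerivAt_exp_mul_coord η 0 x).mul (hasFDerivAt_apply 1 x)).mul
    (hasFDerivAt_apply 2 x)).add
    ((((hasFDerivAt_exp_mul_coord η 0 x).add (hasFDerivAt_exp_neg_mul_coord η 0 x)).sub_const
      2).mul_const (η ^ 2)⁻¹)
  refine (HasFDerivAt.grad_eq (f := C1Eta η) h).trans ?_
  funext l
  fin_cases l <;> simp <;> field_simp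
  ring

/-- C_{0η} is a Casimir function of Π_{0η} and C_{1η} is a Casimir function of
Π_{1η}. -/
theorem deformed_euler_casimirs (η : ℝ) (hη : η ≠ 0) (x : Fin 3 → ℝ) :
    Matrix.mulVec (Pi0Eta η x) (grad (C0Eta η) x) = 0 ∧
    Matrix.mulVec (Pi1Eta η x) (grad (C1Eta η) x) = 0 := by
  have hexp : exp (-2 * η * x 0) = exp (-(η * x 0)) * exp (-(η * x 0)) := by
    rw [← exp_add]
    ring_nf
  have hne := exp_ne_zero (η * x 0)
  rw [grad_C0Eta hη, grad_C1Eta hη, Pi0Eta, Pi1Eta, hexp, exp_neg]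
  constructor <;> funext i <;> fin_cases i <;>
    simp [Matrix.mulVec, dotProduct, Fin.sum_univ_three] <;> field_simp <;> ring
end
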